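/- Every hitomezashi loop has length congruent to 4 modulo 8. -/

import Mathlib

/-- A stitch is a unit segment of the grid: `vert i j` is the vertical segment from
`(i,j)` to `(i,j+1)`; `horiz i j` is the horizontal segment from `(i,j)` to `(i+1,j)`. -/
inductive Stitch : Type
  | vert : ℤ → ℤ → Stitch
  | horiz : ℤ → ℤ → Stitch
  deriving DecidableEq

/-- Membership of a stitch in the hitomezashi pattern with labels `ε` (vertical lines)
and `η` (horizontal lines). -/
def Stitch.InPattern (ε η : ℤ → ZMod 2) : Stitch → Prop
  | .vert i j => (j : ZMod 2) = ε i
  | .horiz i j => (i : ZMod 2) = η j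

/-- The stitch as a subset of the plane. -/
def Stitch.seg : Stitch → Set (ℝ × ℝ)
  | .vert i j => segment ℝ ((i : ℝ), (j : ℝ)) ((i : ℝ), (j : ℝ) + 1)
  | .horiz i j => segment ℝ ((i : ℝ), (j : ℝ)) ((i : ℝ) + 1, (j : ℝ))

/-- The union of the segments of a set of stitches. -/
def curveOf (S : Set Stitch) : Set (ℝ × ℝ) := ⋃ s ∈ S, s.seg

/-- `C` is a simple closed curve: it is homeomorphic to a circle. -/
def IsCircle (C : Set (ℝ × ℝ)) : Prop :=
  Nonempty (C ≃ₜ Metric.sphere (0 : ℝ × ℝ) 1)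

/-- The interior of a closed curve `C`: the union of the bounded connected
components of its complement. -/
def intOf (C : Set (ℝ × ℝ)) : Set (ℝ × ℝ) :=
  {p | p ∉ C ∧ Bornology.IsBounded (connectedComponentIn Cᶜ p)}

/-- The exterior of a closed curve `C`: the union of the unbounded connected
components of its complement. -/
def extOf (C : Set (ℝ × ℝ)) : Set (ℝ × ℝ) :=
  {p | p ∉ C ∧ ¬ Bornology.IsBounded (connectedComponentIn Cᶜ p)}

/-- The open unit cell with southwest corner `(i,j)`. -/
def cell (i j : ℤ) : Set (ℝ × ℝ) :=
  Set.Ioo (i : ℝ) ((i : ℝ) + 1) ×ˢ Set.Ioo (j : ℝ) ((j : ℝ) + 1)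

/-- A hitomezashi loop in the pattern with labels `ε`, `η`: a (finite) set of stitches
of the pattern whose union is a simple closed curve. -/
structure HLoop (ε η : ℤ → ZMod 2) where
  stitches : Finset Stitch
  inPattern : ∀ s ∈ stitches, s.InPattern ε η
  isCircle : IsCircle (curveOf ↑stitches)

section Winding

open Finset

/-- A unit step of the square lattice. -/
def IsUnitStep (e : ℤ × ℤ) : Prop :=
  e = (1, 0) ∨ e = (-1, 0) ∨ e = (0, 1) ∨ e = (0, -1)

/-- For adjacent nonzero lattice points, this is the parity with which the edge joining them
crosses the ray `{(x, 1/2) | 0 < x}`. -/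
def rayCrossing (w w' : ℤ × ℤ) : ZMod 2 :=
  if 0 < w.1 then (if 0 < w.2 then 1 else 0) + (if 0 < w'.2 then 1 else 0) else 0

/-- The indicator of the upper half plane, together with the negative horizontal axis. -/
def upperHalf (w : ℤ × ℤ) : ZMod 2 :=
  if 0 < w.2 ∨ (w.2 = 0 ∧ w.1 < 0) then 1 else 0

lemma rayCrossing_square {w e f : ℤ × ℤ} (he : IsUnitStep e) (hf : IsUnitStep f)
    (h₀ : w ≠ 0) (h₁ : w - e ≠ 0) (h₂ : w + f ≠ 0) (h₃ : w + f - e ≠ 0) :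
    rayCrossing w (w + f) + rayCrossing (w - e) (w + f - e) =
      rayCrossing w (w - e) + rayCrossing (w + f) (w + f - e) := by
  obtain ⟨x, y⟩ := w
  simp only [ne_eq, Prod.ext_iff, Prod.fst_add, Prod.snd_add, Prod.fst_sub, Prod.snd_sub,
    Prod.fst_zero, Prod.snd_zero] at h₀ h₁ h₂ h₃
  rcases he with rfl | rfl | rfl | rfl <;> rcases hf with rfl | rfl | rfl | rfl <;>
  · simp only [rayCrossing, Prod.fst_add, Prod.snd_add, Prod.fst_sub, Prod.snd_sub, add_zero,
      sub_zero, CharTwo.add_self_eq_zero, ite_self]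
    try split_ifs <;> first | rfl | (exfalso; omega)

lemma rayCrossing_add_rayCrossing_neg {w w' : ℤ × ℤ} (h : IsUnitStep (w' - w))
    (h₀ : w ≠ 0) (h₁ : w' ≠ 0) :
    rayCrossing w w' + rayCrossing (-w) (-w') = upperHalf w + upperHalf w' := by
  obtain ⟨x, y⟩ := w
  obtain ⟨x', y'⟩ := w'
  simp only [IsUnitStep, ne_eq, Prod.ext_iff, Prod.fst_sub, Prod.snd_sub,
    Prod.fst_zero, Prod.snd_zero] at h h₀ h₁
  simp only [rayCrossing, upperHalf, Prod.fst_neg, Prod.snd_neg]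
  split_ifs <;> first | rfl | (exfalso; omega)

lemma upperHalf_add_upperHalf_neg {w : ℤ × ℤ} (h : w ≠ 0) :
    upperHalf w + upperHalf (-w) = 1 := by
  obtain ⟨x, y⟩ := w
  simp only [ne_eq, Prod.ext_iff, Prod.fst_zero, Prod.snd_zero] at h
  simp only [upperHalf, Prod.fst_neg, Prod.snd_neg]
  split_ifs <;> first | rfl | (exfalso; omega)

lemma IsUnitStep.neg {e : ℤ × ℤ} (h : IsUnitStep e) : IsUnitStep (-e) := by
  rcases h with rfl | rfl | rfl | rfl <;> simp [IsUnitStep]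

/-- A sum over a full period is invariant under a shift. -/
lemma sum_range_succ_of_periodic {M : Type*} [AddCommGroup M] {f : ℕ → M} {N : ℕ}
    (h : ∀ s, f (s + N) = f s) : ∑ s ∈ range N, f (s + 1) = ∑ s ∈ range N, f s := by
  have := (sum_range_succ' f N).symm.trans (sum_range_succ f N)
  have h0 := h 0
  rw [zero_add] at h0
  rw [h0] at this
  exact add_right_cancel this

/-- Parity of the winding number around the origin of the zigzag path through the chords
`v (s + d) - v s` and `v (s + d + 1) - v s`. -/
def chordWinding (v : ℕ → ℤ × ℤ) (N d : ℕ) : ZMod 2 :=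
  ∑ s ∈ range N, (rayCrossing (v (s + d) - v s) (v (s + d + 1) - v s) +
    rayCrossing (v (s + d + 1) - v s) (v (s + d + 1) - v (s + 1)))

section ClosedPath

variable {v : ℕ → ℤ × ℤ} {N : ℕ}

lemma chord_square (hstep : ∀ t, IsUnitStep (v (t + 1) - v t))
    (hinj : ∀ s t, s < t → t < s + N → v t ≠ v s) {d : ℕ} (hd : 2 ≤ d) (hdN : d + 1 < N)
    (s : ℕ) :
    rayCrossing (v (s + d) - v s) (v (s + d + 1) - v s) +
        rayCrossing (v (s + d) - v (s + 1)) (v (s + d + 1) - v (s + 1)) =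
      rayCrossing (v (s + d) - v s) (v (s + d) - v (s + 1)) +
        rayCrossing (v (s + d + 1) - v s) (v (s + d + 1) - v (s + 1)) := by
  have := rayCrossing_square (w := v (s + d) - v s) (hstep s) (hstep (s + d))
  simp only [sub_sub_sub_cancel_right, sub_add_sub_cancel', ne_eq, sub_eq_zero] at this
  exact this (hinj _ _ (by omega) (by omega)) (hinj _ _ (by omega) (by omega))
    (hinj _ _ (by omega) (by omega)) (hinj _ _ (by omega) (by omega))

lemma chordWinding_succ (hper : ∀ t, v (t + N) = v t)
    (hstep : ∀ t, IsUnitStep (v (t + 1) - v t))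
    (hinj : ∀ s t, s < t → t < s + N → v t ≠ v s) {d : ℕ} (hd : 1 ≤ d) (hdN : d + 2 < N) :
    chordWinding v N (d + 1) = chordWinding v N d := by
  have hshift := sum_range_succ_of_periodic (N := N)
    (f := fun s ↦ rayCrossing (v (s + d) - v s) (v (s + d + 1) - v s)) (fun s ↦ by
      have h (k : ℕ) : v (s + N + k) = v (s + k) := by
        rw [add_right_comm, hper]
      have h1 := h (d + 1)
      simp only [← add_assoc] at h1
      simp only [h, h1, hper])
  rw [chordWinding, chordWinding, sum_add_distrib, sum_add_distrib, ← hshift, ← sum_add_distrib,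
    ← sum_add_distrib]
  refine sum_congr rfl fun s _ ↦ ?_
  have h := chord_square hstep hinj (d := d + 1) (by omega) (by omega) s
  have e : s + 1 + d = s + d + 1 := by omega
  have e' : s + (d + 1) = s + d + 1 := by omega
  simp only [e, e'] at h ⊢
  generalize rayCrossing (v (s + d + 1) - v s) (v (s + d + 1 + 1) - v s) = a at *
  generalize rayCrossing (v (s + d + 1) - v (s + 1)) (v (s + d + 1 + 1) - v (s + 1)) = b at *
  generalize rayCrossing (v (s + d + 1) - v s) (v (s + d + 1) - v (s + 1)) = c at *
  generalize rayCrossing (v (s + d + 1 + 1) - v s) (v (s + d + 1 + 1) - v (s + 1)) = d at *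
  revert a b c d
  decide

/-- The chords joining opposite points of a simple closed path form a centrally symmetric closed
path, which winds around the origin an odd number of times. -/
lemma chordWinding_half {n : ℕ} (hn : 2 ≤ n) (hper : ∀ t, v (t + 2 * n) = v t)
    (hstep : ∀ t, IsUnitStep (v (t + 1) - v t))
    (hinj : ∀ s t, s < t → t < s + 2 * n → v t ≠ v s) :
    chordWinding v (2 * n) n = 1 := by
  have key (s : ℕ) : (rayCrossing (v (s + n) - v s) (v (s + n + 1) - v s) +
      rayCrossing (v (s + n + 1) - v s) (v (s + n + 1) - v (s + 1))) +
      (rayCrossing (v (n + s + n) - v (n + s)) (v (n + s + n + 1) - v (n + s)) +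
      rayCrossing (v (n + s + n + 1) - v (n + s)) (v (n + s + n + 1) - v (n + s + 1))) =
      upperHalf (v (s + 1 + n) - v (s + 1)) - upperHalf (v (s + n) - v s) := by
    have e1 : v (n + s + n) = v s := by rw [← hper s]; congr 1; omega
    have e2 : v (n + s + n + 1) = v (s + 1) := by rw [← hper (s + 1)]; congr 1; omega
    have e3 : n + s = s + n := by omega
    have e4 : s + 1 + n = s + n + 1 := by omega
    have hsq := chord_square hstep hinj (d := n) (by omega) (by omega) s
    have h0 : v (s + n) - v s ≠ 0 := sub_ne_zero.2 (hinj _ _ (by omega) (by omega))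
    have h1 : v (s + n) - v (s + 1) ≠ 0 := sub_ne_zero.2 (hinj _ _ (by omega) (by omega))
    have h2 : v (s + n + 1) - v (s + 1) ≠ 0 := sub_ne_zero.2 (hinj _ _ (by omega) (by omega))
    have s1 := rayCrossing_add_rayCrossing_neg (w := v (s + n) - v s) (w' := v (s + n) - v (s + 1))
      (by rw [sub_sub_sub_cancel_left, ← neg_sub]; exact (hstep s).neg) h0 h1
    have s2 := rayCrossing_add_rayCrossing_neg (w := v (s + n) - v (s + 1))
      (w' := v (s + n + 1) - v (s + 1))
      (by rw [sub_sub_sub_cancel_right]; exact hstep _) h1 h2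
    simp only [neg_sub] at s1 s2
    rw [e1, e2, e3, e4, CharTwo.sub_eq_add (upperHalf _)]
    linear_combination hsq + s1 + s2
      + (rayCrossing (v (s + n + 1) - v s) (v (s + n + 1) - v (s + 1))
      - rayCrossing (v (s + n) - v (s + 1)) (v (s + n + 1) - v (s + 1))
      + upperHalf (v (s + n) - v (s + 1))) * CharTwo.two_eq_zero (R := ZMod 2)
  have hsum := sum_range_sub (fun s ↦ upperHalf (v (s + n) - v s)) n
  rw [chordWinding, two_mul, sum_range_add, ← sum_add_distrib, sum_congr rfl fun s _ ↦ key s, hsum]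
  have h0 : v (0 + n) - v 0 ≠ 0 := sub_ne_zero.2 (hinj _ _ (by omega) (by omega))
  have e : v (n + n) - v n = -(v (0 + n) - v 0) := by
    rw [← hper 0, neg_sub, zero_add, zero_add, two_mul]
  rw [e, CharTwo.sub_eq_add, add_comm, upperHalf_add_upperHalf_neg h0]

/-- A mod 2 form of Hopf's theorem on turning numbers, for simple closed lattice paths. -/
lemma chordWinding_one {n : ℕ} (hn : 2 ≤ n) (hper : ∀ t, v (t + 2 * n) = v t)
    (hstep : ∀ t, IsUnitStep (v (t + 1) - v t))
    (hinj : ∀ s t, s < t → t < s + 2 * n → v t ≠ v s) :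
    chordWinding v (2 * n) 1 = 1 := by
  have h (d : ℕ) (hd : 1 ≤ d) : d ≤ n → chordWinding v (2 * n) d = chordWinding v (2 * n) 1 := by
    induction d, hd using Nat.le_induction with
    | base => simp
    | succ d hd ih =>
      intro hdn
      rw [chordWinding_succ hper hstep hinj hd (by omega), ih (by omega)]
  rw [← h n (by omega) le_rfl, chordWinding_half hn hper hstep hinj]

end ClosedPath

/-- Every function on `ℤ` has a discrete antiderivative. -/
lemma exists_discrete_antiderivative (f : ℤ → ℤ) : ∃ G : ℤ → ℤ, ∀ x, G (x + 1) - G x = f x := by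
  refine ⟨fun x ↦ ∑ i ∈ Ico 0 x, f i - ∑ i ∈ Ico x 0, f i, fun x ↦ ?_⟩
  rcases le_or_gt 0 x with hx | hx
  · have h : Ico 0 (x + 1) = insert x (Ico 0 x) := by ext; simp; omega
    simp [h, Ico_eq_empty_of_le hx, Ico_eq_empty_of_le (hx.trans (Int.le_add_one le_rfl))]
  · have h : Ico x 0 = insert x (Ico (x + 1) 0) := by ext; simp; omega
    simp [h, Ico_eq_empty_of_le hx.le, Ico_eq_empty_of_le (Int.add_one_le_iff.2 hx)]

lemma sum_range_two_mul {M : Type*} [AddCommMonoid M] (f : ℕ → M) (n : ℕ) :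
    ∑ s ∈ range (2 * n), f s = ∑ t ∈ range n, (f (2 * t) + f (2 * t + 1)) := by
  induction n with
  | zero => simp
  | succ n ih => rw [mul_add, mul_one, sum_range_succ, sum_range_succ, ih, sum_range_succ, add_assoc]

/-- In a closed path `x 0, x 1, …` with unit steps in `ℤ`, the straight passages through each
point cancel in pairs according to their directions. -/
lemma sum_straight_eq_zero {x : ℕ → ℤ} {n : ℕ} (hx : ∀ t, x (t + n) = x t)
    (hstep : ∀ t, x (t + 1) - x t = 1 ∨ x (t + 1) - x t = -1) (β : ℤ → ℤ) :
    ∑ t ∈ range n, β (x (t + 1)) * ((x (t + 1) - x t) + (x (t + 2) - x (t + 1))) = 0 := by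
  obtain ⟨G, hG⟩ := exists_discrete_antiderivative fun z ↦ β z + β (z + 1)
  have hG' (t : ℕ) : G (x (t + 1)) - G (x t) =
      β (x (t + 1)) * (x (t + 1) - x t) + β (x t) * (x (t + 1) - x t) := by
    rcases hstep t with h | h
    · rw [h, show x (t + 1) = x t + 1 by omega]
      linarith [hG (x t)]
    · have hGt := hG (x (t + 1))
      rw [show x (t + 1) + 1 = x t by omega] at hGt
      rw [h]
      linarith
  have hsum := sum_range_sub (fun t ↦ G (x t)) n
  have hshift := sum_range_succ_of_periodic (N := n) (f := fun t ↦ β (x t) * (x (t + 1) - x t))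
    fun t ↦ by rw [hx, add_right_comm, hx]
  have h0 := hx 0
  rw [zero_add] at h0
  rw [h0, sub_self, sum_congr rfl fun t _ ↦ hG' t, sum_add_distrib, ← hshift, ← sum_add_distrib]
    at hsum
  rw [← hsum]
  exact sum_congr rfl fun t _ ↦ by ring

/-- The map `(x, y) ↦ (x', y + b x')`, `x' = x + a y`, with `a = 2 α - 1` and `b = 2 β - 1`
taking the values `±1`, has only periods congruent to `2` modulo `4`. -/
lemma period_mod_four {α β : ℤ → ℤ} (hα : ∀ z, α z = 0 ∨ α z = 1) (hβ : ∀ z, β z = 0 ∨ β z = 1)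
    {x y : ℕ → ℤ} (hx : ∀ t, x (t + 1) = x t + (2 * α (y t) - 1))
    (hy : ∀ t, y (t + 1) = y t + (2 * β (x (t + 1)) - 1)) {n : ℕ} (hn : 0 < n)
    (hxn : ∀ t, x (t + n) = x t) (hyn : ∀ t, y (t + n) = y t)
    (hinj : ∀ s t, s < t → t < s + n → x t = x s → y t ≠ y s) (heven : Even (x 0 + y 0)) :
    n % 4 = 2 := by
  have hpar (t : ℕ) : Even (x t + y t) := by
    induction t with
    | zero => exact heven
    | succ t ih =>
      rw [hy, hx]
      rw [Int.even_iff] at *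
      omega
  have hn2 : 2 ≤ n := by
    by_contra h
    obtain rfl : n = 1 := by omega
    have h0 := hx 0
    rw [hxn 0] at h0
    omega
  set v : ℕ → ℤ × ℤ := fun k ↦ (x ((k + 1) / 2), y (k / 2)) with hv
  have v_even (t : ℕ) : v (2 * t) = (x t, y t) := by
    simp only [hv]; congr 2 <;> omega
  have v_odd (t : ℕ) : v (2 * t + 1) = (x (t + 1), y t) := by
    simp only [hv]; congr 2 <;> omega
  have v_even' (t : ℕ) : v (2 * t + 2) = (x (t + 1), y (t + 1)) := v_even (t + 1)
  have v_odd' (t : ℕ) : v (2 * t + 3) = (x (t + 2), y (t + 1)) := v_odd (t + 1)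
  have hper (k : ℕ) : v (k + 2 * n) = v k := by
    simp only [hv]
    rw [← hxn ((k + 1) / 2), ← hyn (k / 2)]
    congr 2 <;> omega
  have hstep (k : ℕ) : IsUnitStep (v (k + 1) - v k) := by
    rcases k.even_or_odd' with ⟨t, rfl | rfl⟩
    · rw [v_even, v_odd, hx]
      rcases hα (y t) with h | h <;> simp [h, IsUnitStep]
    · rw [v_odd, add_assoc, v_even', hy]
      rcases hβ (x (t + 1)) with h | h <;> simp [h, IsUnitStep]
  have hvinj (k l : ℕ) (hkl : k < l) (hlk : l < k + 2 * n) : v l ≠ v k := by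
    rcases k.even_or_odd' with ⟨s, rfl | rfl⟩ <;> rcases l.even_or_odd' with ⟨t, rfl | rfl⟩
    · rw [v_even, v_even]
      intro h
      exact hinj s t (by omega) (by omega) (congrArg Prod.fst h) (congrArg Prod.snd h)
    · rw [v_even, v_odd, ne_eq, Prod.ext_iff]
      have h1 := hpar s
      have h2 := hpar t
      have h3 := hx t
      rw [Int.even_iff] at h1 h2
      dsimp only
      omega
    · rw [v_even, v_odd, ne_eq, Prod.ext_iff]
      have h1 := hpar s
      have h2 := hpar t
      have h3 := hx s
      rw [Int.even_iff] at h1 h2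
      dsimp only
      omega
    · rw [v_odd, v_odd]
      intro h
      have h1 : x (t + 1) = x (s + 1) := congrArg Prod.fst h
      have h2 : y t = y s := congrArg Prod.snd h
      rw [hx, hx, h2] at h1
      exact hinj s t (by omega) (by omega) (by omega) h2
  have hwind := chordWinding_one hn2 hper hstep hvinj
  have hterm (t : ℕ) :
      (rayCrossing (v (2 * t + 1) - v (2 * t)) (v (2 * t + 1 + 1) - v (2 * t)) +
        rayCrossing (v (2 * t + 1 + 1) - v (2 * t)) (v (2 * t + 1 + 1) - v (2 * t + 1))) +
      (rayCrossing (v (2 * t + 1 + 1) - v (2 * t + 1)) (v (2 * t + 1 + 1 + 1) - v (2 * t + 1)) +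
        rayCrossing (v (2 * t + 1 + 1 + 1) - v (2 * t + 1))
          (v (2 * t + 1 + 1 + 1) - v (2 * t + 1 + 1))) =
      ((β (x (t + 1)) * (α (y t) + α (y (t + 1))) : ℤ) : ZMod 2) := by
    simp only [add_assoc, Nat.reduceAdd, v_even, v_odd, v_even', v_odd', Prod.mk_sub_mk]
    have d1 : x (t + 1) - x t = 2 * α (y t) - 1 := by rw [hx]; ring
    have d2 : x (t + 2) - x (t + 1) = 2 * α (y (t + 1)) - 1 := by rw [hx (t + 1)]; ring
    have d3 : y (t + 1) - y t = 2 * β (x (t + 1)) - 1 := by rw [hy]; ring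
    simp only [d1, d2, d3, sub_self]
    rcases hα (y t) with h1 | h1 <;> rcases hα (y (t + 1)) with h2 | h2 <;>
      rcases hβ (x (t + 1)) with h3 | h3 <;> simp [h1, h2, h3, rayCrossing]
    all_goals decide
  rw [chordWinding, sum_range_two_mul, sum_congr rfl fun t _ ↦ hterm t, ← Int.cast_sum] at hwind
  have hstraight := sum_straight_eq_zero hxn
    (fun t ↦ by rw [hx]; rcases hα (y t) with h | h <;> simp [h]) β
  have hB : ∑ t ∈ range n, β (x (t + 1)) * (α (y t) + α (y (t + 1))) =
      ∑ t ∈ range n, β (x (t + 1)) := by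
    have h (t : ℕ) : β (x (t + 1)) * ((x (t + 1) - x t) + (x (t + 2) - x (t + 1))) =
        2 * (β (x (t + 1)) * (α (y t) + α (y (t + 1))) - β (x (t + 1))) := by
      rw [hx (t + 1), hx t]; ring
    rw [sum_congr rfl fun t _ ↦ h t, ← mul_sum, sum_sub_distrib] at hstraight
    omega
  have hcount : 2 * ∑ t ∈ range n, β (x (t + 1)) = n := by
    have h := sum_range_sub y n
    have h0 := hyn 0
    rw [zero_add] at h0
    rw [h0, sub_self, sum_congr rfl fun t _ ↦ show y (t + 1) - y t = 2 * β (x (t + 1)) - 1 by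
      rw [hy]; ring, sum_sub_distrib, ← mul_sum, sum_const, card_range, nsmul_one] at h
    linarith
  rw [hB] at hwind
  have hodd : Odd (∑ t ∈ range n, β (x (t + 1))) := by
    rw [← ZMod.intCast_eq_one_iff_odd]; exact hwind
  rw [Int.odd_iff] at hodd
  omega

end Winding

section Circle

lemma isPreconnected_sphere_diff_singleton {E : Type*} [NormedAddCommGroup E] [NormedSpace ℝ E]
    {p : E} (hp : p ∈ Metric.sphere (0 : E) 1) :
    IsPreconnected (Metric.sphere (0 : E) 1 \ {p}) := by
  have hp1 : ‖p‖ = 1 := by simpa using hp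
  have hp0 : p ≠ 0 := norm_ne_zero_iff.1 (by rw [hp1]; exact one_ne_zero)
  set A : Set E := {v | ∀ r : ℝ, 0 ≤ r → v ≠ r • p} with hA
  have hstar : StarConvex ℝ (-p) A := by
    intro y hy a b ha hb hab r hr h
    have hby : b • y = (r + a) • p := by
      rw [add_smul, ← h]; simp
    rcases hb.eq_or_lt with rfl | hb
    · rw [zero_smul, eq_comm, smul_eq_zero] at hby
      rcases hby with h0 | h0
      · linarith
      · exact hp0 h0
    · refine hy ((r + a) / b) (by positivity) ?_
      rw [div_eq_inv_mul, mul_smul, ← hby, inv_smul_smul₀ hb.ne']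
  have hmem : -p ∈ A := by
    intro r hr h
    have h' : (r + 1) • p = 0 := by rw [add_smul, ← h]; simp
    rcases smul_eq_zero.1 h' with h0 | h0
    · linarith
    · exact hp0 h0
  have hAne {v : E} (hv : v ∈ A) : v ≠ 0 := by simpa using hv 0 le_rfl
  have himage : (fun v : E ↦ ‖v‖⁻¹ • v) '' A = Metric.sphere (0 : E) 1 \ {p} := by
    ext q
    constructor
    · rintro ⟨v, hv, rfl⟩
      refine ⟨by simp [norm_smul, hAne hv], fun h ↦ hv ‖v‖ (norm_nonneg v) ?_⟩
      rw [← Set.mem_singleton_iff.1 h, smul_inv_smul₀ (norm_ne_zero_iff.2 (hAne hv))]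
    · rintro ⟨hq, hqp⟩
      have hq1 : ‖q‖ = 1 := by simpa using hq
      refine ⟨q, fun r hr h ↦ hqp ?_, by simp [hq1]⟩
      have : r = 1 := by rw [h, norm_smul, hp1, mul_one, Real.norm_of_nonneg hr] at hq1; exact hq1
      rw [Set.mem_singleton_iff, h, this, one_smul]
  rw [← himage]
  refine (hstar.isPathConnected hmem).isConnected.isPreconnected.image _ ?_
  exact (continuous_norm.continuousOn.inv₀ fun v hv ↦ norm_ne_zero_iff.2 (hAne hv)).smul
    continuousOn_id

variable {C : Set (ℝ × ℝ)}

lemma IsCircle.isPreconnected (hC : IsCircle C) : IsPreconnected C := by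
  obtain ⟨f⟩ := hC
  have hrank : 1 < Module.rank ℝ (ℝ × ℝ) := by simp [one_add_one_eq_two]
  have := isPreconnected_iff_preconnectedSpace.1 (isPreconnected_sphere hrank 0 1)
  have := f.symm.surjective.denseRange.preconnectedSpace f.symm.continuous
  exact isPreconnected_iff_preconnectedSpace.2 this

lemma IsCircle.nonempty (hC : IsCircle C) : C.Nonempty := by
  obtain ⟨f⟩ := hC
  exact ⟨_, (f.symm ⟨(1, 0), by simp [Prod.norm_def]⟩).2⟩

lemma IsCircle.isPreconnected_diff_singleton (hC : IsCircle C) {m : ℝ × ℝ} (hm : m ∈ C) :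
    IsPreconnected (C \ {m}) := by
  obtain ⟨f⟩ := hC
  have h := isPreconnected_sphere_diff_singleton (f ⟨m, hm⟩).2
  have h' : Metric.sphere (0 : ℝ × ℝ) 1 \ {(f ⟨m, hm⟩ : ℝ × ℝ)} =
      Subtype.val '' (f '' {(⟨m, hm⟩ : C)}ᶜ) := by
    ext q
    simp only [Set.mem_sdiff, Set.mem_singleton_iff, Set.mem_image, Set.mem_compl_iff]
    constructor
    · rintro ⟨hq, hqm⟩
      refine ⟨⟨q, hq⟩, ⟨f.symm ⟨q, hq⟩, fun h ↦ hqm ?_, by simp⟩, rfl⟩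
      rw [← h]; simp
    · rintro ⟨_, ⟨c, hc, rfl⟩, rfl⟩
      exact ⟨(f c).2, fun h ↦ hc (f.injective (Subtype.ext h))⟩
  rw [h', Topology.IsInducing.subtypeVal.isPreconnected_image, f.isPreconnected_image] at h
  convert h.image (fun x : C ↦ (x : ℝ × ℝ)) continuous_subtype_val.continuousOn using 1
  ext q
  simp

end Circle

namespace Stitch

/-- The lattice point `p` is an endpoint of the stitch. -/
def Incident : Stitch → ℤ × ℤ → Prop
  | .vert i j, p => p.1 = i ∧ (p.2 = j ∨ p.2 = j + 1)
  | .horiz i j, p => (p.1 = i ∨ p.1 = i + 1) ∧ p.2 = j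

lemma mem_seg_vert {i j : ℤ} {z : ℝ × ℝ} :
    z ∈ (vert i j).seg ↔ z.1 = i ∧ (j : ℝ) ≤ z.2 ∧ z.2 ≤ j + 1 := by
  obtain ⟨a, b⟩ := z
  rw [seg, ← Prod.image_mk_segment_right, segment_eq_Icc (by linarith)]
  simp only [Set.mem_image, Set.mem_Icc, Prod.mk.injEq]
  grind

lemma mem_seg_horiz {i j : ℤ} {z : ℝ × ℝ} :
    z ∈ (horiz i j).seg ↔ ((i : ℝ) ≤ z.1 ∧ z.1 ≤ i + 1) ∧ z.2 = j := by
  obtain ⟨a, b⟩ := z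
  rw [seg, ← Prod.image_mk_segment_left, segment_eq_Icc (by linarith)]
  simp only [Set.mem_image, Set.mem_Icc, Prod.mk.injEq]
  grind

lemma isClosed_seg (s : Stitch) : IsClosed s.seg := by
  have h (x y : ℝ × ℝ) : IsClosed (segment ℝ x y) := by
    rw [segment_eq_image]
    exact (isCompact_Icc.image (by fun_prop)).isClosed
  cases s <;> exact h _ _

lemma Incident.mem_seg {s : Stitch} {p : ℤ × ℤ} (h : s.Incident p) :
    ((p.1 : ℝ), (p.2 : ℝ)) ∈ s.seg := by
  obtain ⟨a, b⟩ := p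
  cases s with
  | vert i j =>
    rcases h with ⟨rfl, rfl | rfl⟩ <;> simp [mem_seg_vert]
  | horiz i j =>
    rcases h with ⟨rfl | rfl, rfl⟩ <;> simp [mem_seg_horiz]

/-- Distinct stitches can only meet in a common endpoint. -/
lemma exists_incident_of_mem_seg {s s' : Stitch} (hne : s ≠ s') {z : ℝ × ℝ} (hz : z ∈ s.seg)
    (hz' : z ∈ s'.seg) :
    ∃ p : ℤ × ℤ, z = ((p.1 : ℝ), (p.2 : ℝ)) ∧ s.Incident p ∧ s'.Incident p := by
  obtain ⟨a, b⟩ := z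
  rcases s with ⟨i, j⟩ | ⟨i, j⟩ <;> rcases s' with ⟨i', j'⟩ | ⟨i', j'⟩ <;>
    simp only [mem_seg_vert, mem_seg_horiz] at hz hz'
  · obtain ⟨rfl, h1, h2⟩ := hz
    obtain ⟨hi, h3, h4⟩ := hz'
    obtain rfl : i = i' := by exact_mod_cast hi
    have h5 : j ≤ j' + 1 := by exact_mod_cast h1.trans h4
    have h6 : j' ≤ j + 1 := by exact_mod_cast h3.trans h2
    have h7 : j ≠ j' := by rintro rfl; exact hne rfl
    rcases (by omega : j = j' + 1 ∨ j' = j + 1) with rfl | rfl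
    · push_cast at h1
      exact ⟨(i, j' + 1), by ext <;> push_cast <;> linarith, by simp [Incident]⟩
    · push_cast at h3
      exact ⟨(i, j + 1), by ext <;> push_cast <;> linarith, by simp [Incident]⟩
  · obtain ⟨rfl, h1, h2⟩ := hz
    obtain ⟨⟨h3, h4⟩, rfl⟩ := hz'
    refine ⟨(i, j'), rfl, ?_⟩
    norm_cast at h1 h2 h3 h4
    dsimp only [Incident]
    omega
  · obtain ⟨rfl, h1, h2⟩ := hz'
    obtain ⟨⟨h3, h4⟩, rfl⟩ := hz
    refine ⟨(i', j), rfl, ?_⟩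
    norm_cast at h1 h2 h3 h4
    dsimp only [Incident]
    omega
  · obtain ⟨⟨h1, h2⟩, rfl⟩ := hz
    obtain ⟨⟨h3, h4⟩, hj⟩ := hz'
    obtain rfl : j = j' := by exact_mod_cast hj
    have h5 : i ≤ i' + 1 := by exact_mod_cast h1.trans h4
    have h6 : i' ≤ i + 1 := by exact_mod_cast h3.trans h2
    have h7 : i ≠ i' := by rintro rfl; exact hne rfl
    rcases (by omega : i = i' + 1 ∨ i' = i + 1) with rfl | rfl
    · push_cast at h1
      exact ⟨(i' + 1, j), by ext <;> push_cast <;> linarith, by simp [Incident]⟩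
    · push_cast at h3
      exact ⟨(i + 1, j), by ext <;> push_cast <;> linarith, by simp [Incident]⟩

/-- The midpoint of a stitch separates it into the parts near to and far from an endpoint. -/
lemma Incident.exists_midpoint {s : Stitch} {p : ℤ × ℤ} (h : s.Incident p) :
    ∃ m ∈ s.seg, m ≠ ((p.1 : ℝ), (p.2 : ℝ)) ∧
      (∃ q ∈ s.seg, 1 / 2 ≤ dist q ((p.1 : ℝ), (p.2 : ℝ)) ∧ q ≠ m) ∧
      ∀ z ∈ s.seg, dist z ((p.1 : ℝ), (p.2 : ℝ)) = 1 / 2 → z = m := by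
  obtain ⟨a, b⟩ := p
  cases s with
  | vert i j =>
    refine ⟨((i : ℝ), j + 1 / 2), mem_seg_vert.2 ⟨rfl, by norm_num, by norm_num⟩, ?_⟩
    rcases h with ⟨rfl, rfl | rfl⟩ <;> dsimp only <;> push_cast
    · refine ⟨by simp, ⟨((a : ℝ), b + 1), ?_, ?_, ?_⟩, ?_⟩
      · simp [mem_seg_vert]
      · simp [Prod.dist_eq]
        norm_num
      · simp
      · rintro ⟨x, y⟩ hz hd
        obtain ⟨h1, h2, h3⟩ := mem_seg_vert.1 hz
        dsimp only at h1 h2 h3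
        subst h1
        rw [Prod.dist_eq, dist_self, max_eq_right dist_nonneg, Real.dist_eq,
          abs_of_nonneg (by linarith)] at hd
        ext <;> simp; linarith
    · refine ⟨by simp, ⟨((a : ℝ), j), ?_, ?_, ?_⟩, ?_⟩
      · simp [mem_seg_vert]
      · simp [Prod.dist_eq]
        norm_num
      · simp
      · rintro ⟨x, y⟩ hz hd
        obtain ⟨h1, h2, h3⟩ := mem_seg_vert.1 hz
        dsimp only at h1 h2 h3
        subst h1
        rw [Prod.dist_eq, dist_self, max_eq_right dist_nonneg, Real.dist_eq,
          abs_of_nonpos (by linarith)] at hd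
        ext <;> simp; linarith
  | horiz i j =>
    refine ⟨((i : ℝ) + 1 / 2, j), mem_seg_horiz.2 ⟨⟨by norm_num, by norm_num⟩, rfl⟩, ?_⟩
    rcases h with ⟨rfl | rfl, rfl⟩ <;> dsimp only <;> push_cast
    · refine ⟨by simp, ⟨((a : ℝ) + 1, b), ?_, ?_, ?_⟩, ?_⟩
      · simp [mem_seg_horiz]
      · simp [Prod.dist_eq]
        norm_num
      · simp
      · rintro ⟨x, y⟩ hz hd
        obtain ⟨⟨h2, h3⟩, h1⟩ := mem_seg_horiz.1 hz
        dsimp only at h1 h2 h3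
        subst h1
        rw [Prod.dist_eq, dist_self, max_eq_left dist_nonneg, Real.dist_eq,
          abs_of_nonneg (by linarith)] at hd
        ext <;> simp; linarith
    · refine ⟨by simp, ⟨((i : ℝ), b), ?_, ?_, ?_⟩, ?_⟩
      · simp [mem_seg_horiz]
      · simp [Prod.dist_eq]
        norm_num
      · simp
      · rintro ⟨x, y⟩ hz hd
        obtain ⟨⟨h2, h3⟩, h1⟩ := mem_seg_horiz.1 hz
        dsimp only at h1 h2 h3
        subst h1
        rw [Prod.dist_eq, dist_self, max_eq_left dist_nonneg, Real.dist_eq,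
          abs_of_nonpos (by linarith)] at hd
        ext <;> simp; linarith

lemma exists_incident_even (s : Stitch) : ∃ p : ℤ × ℤ, s.Incident p ∧ Even (p.1 + p.2) := by
  cases s with
  | vert i j =>
    rcases Int.even_or_odd (i + j) with h | h
    · exact ⟨(i, j), by simp [Incident], h⟩
    · exact ⟨(i, j + 1), by simp [Incident], by simpa [add_assoc] using h.add_one⟩
  | horiz i j =>
    rcases Int.even_or_odd (i + j) with h | h
    · exact ⟨(i, j), by simp [Incident], h⟩
    · exact ⟨(i + 1, j), by simp [Incident], by simpa [add_right_comm] using h.add_one⟩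

lemma Incident.eq_or_eq {s : Stitch} {p q r : ℤ × ℤ} (hp : s.Incident p) (hq : s.Incident q)
    (hr : s.Incident r) (hne : p ≠ q) : r = p ∨ r = q := by
  rw [ne_eq, Prod.ext_iff] at hne
  rw [Prod.ext_iff, Prod.ext_iff]
  cases s <;> simp only [Incident] at hp hq hr <;> omega

/-- At most two stitches of a hitomezashi pattern share an endpoint. -/
lemma InPattern.eq_or_eq {ε η : ℤ → ZMod 2} {s₁ s₂ s₃ : Stitch} (h₁ : s₁.InPattern ε η)
    (h₂ : s₂.InPattern ε η) (h₃ : s₃.InPattern ε η) {p : ℤ × ℤ} (hp₁ : s₁.Incident p)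
    (hp₂ : s₂.Incident p) (hp₃ : s₃.Incident p) (hne : s₁ ≠ s₂) : s₃ = s₁ ∨ s₃ = s₂ := by
  have hvert {i j i' j' : ℤ} (h : (vert i j).InPattern ε η) (h' : (vert i' j').InPattern ε η)
      (hp : (vert i j).Incident p) (hp' : (vert i' j').Incident p) : vert i j = vert i' j' := by
    obtain ⟨rfl, hj⟩ := hp
    obtain ⟨rfl, hj'⟩ := hp'
    have := (ZMod.intCast_eq_intCast_iff_dvd_sub _ _ 2).1 (Eq.trans h h'.symm)
    rw [show j = j' by omega]
  have hhoriz {i j i' j' : ℤ} (h : (horiz i j).InPattern ε η) (h' : (horiz i' j').InPattern ε η)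
      (hp : (horiz i j).Incident p) (hp' : (horiz i' j').Incident p) :
      horiz i j = horiz i' j' := by
    obtain ⟨hi, rfl⟩ := hp
    obtain ⟨hi', rfl⟩ := hp'
    have := (ZMod.intCast_eq_intCast_iff_dvd_sub _ _ 2).1 (Eq.trans h h'.symm)
    rw [show i = i' by omega]
  rcases s₁ with ⟨i₁, j₁⟩ | ⟨i₁, j₁⟩ <;> rcases s₂ with ⟨i₂, j₂⟩ | ⟨i₂, j₂⟩ <;>
    rcases s₃ with ⟨i₃, j₃⟩ | ⟨i₃, j₃⟩
  · exact .inl (hvert h₃ h₁ hp₃ hp₁)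
  · exact absurd (hvert h₁ h₂ hp₁ hp₂) hne
  · exact .inl (hvert h₃ h₁ hp₃ hp₁)
  · exact .inr (hhoriz h₃ h₂ hp₃ hp₂)
  · exact .inr (hvert h₃ h₂ hp₃ hp₂)
  · exact .inl (hhoriz h₃ h₁ hp₃ hp₁)
  · exact absurd (hhoriz h₁ h₂ hp₁ hp₂) hne
  · exact .inl (hhoriz h₃ h₁ hp₃ hp₁)

end Stitch

lemma isClosed_curveOf {S : Set Stitch} (hS : S.Finite) : IsClosed (curveOf S) :=
  hS.isClosed_biUnion fun s _ ↦ s.isClosed_seg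

lemma Stitch.seg_subset_curveOf {S : Set Stitch} {s : Stitch} (hs : s ∈ S) :
    s.seg ⊆ curveOf S :=
  Set.subset_biUnion_of_mem (u := Stitch.seg) hs

/-- A simple closed curve has no dead ends. -/
lemma IsCircle.exists_ne_incident {S : Set Stitch} (hS : S.Finite) (hC : IsCircle (curveOf S))
    {s : Stitch} (hs : s ∈ S) {p : ℤ × ℤ} (hp : s.Incident p) :
    ∃ s' ∈ S, s' ≠ s ∧ s'.Incident p := by
  by_contra! hdead
  obtain ⟨m, hms, hmp, ⟨q, hqs, hqp, hqm⟩, hm⟩ := hp.exists_midpoint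
  set P : ℝ × ℝ := ((p.1 : ℝ), (p.2 : ℝ)) with hP
  have hpre := isPreconnected_closed_iff.1
    (hC.isPreconnected_diff_singleton (Stitch.seg_subset_curveOf hs hms))
    (s.seg ∩ Metric.closedBall P (1 / 2))
    ((s.seg ∩ {z | 1 / 2 ≤ dist z P}) ∪ curveOf (S \ {s}))
    (s.isClosed_seg.inter Metric.isClosed_closedBall)
    ((s.isClosed_seg.inter (isClosed_le continuous_const (by fun_prop))).union
      (isClosed_curveOf (hS.subset Set.sdiff_subset)))
    (by
      rintro z ⟨hz, -⟩
      obtain ⟨s', hs', hz'⟩ := Set.mem_iUnion₂.1 hz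
      rcases eq_or_ne s' s with rfl | hne
      · rcases le_total (dist z P) (1 / 2) with h | h
        · exact .inl ⟨hz', h⟩
        · exact .inr (.inl ⟨hz', h⟩)
      · exact .inr (.inr (Stitch.seg_subset_curveOf (Set.mem_sdiff_singleton.2 ⟨hs', hne⟩) hz')))
    ⟨P, ⟨Stitch.seg_subset_curveOf hs hp.mem_seg, hmp.symm⟩, hp.mem_seg, by simp⟩
    ⟨q, ⟨Stitch.seg_subset_curveOf hs hqs, hqm⟩, .inl ⟨hqs, hqp⟩⟩
  obtain ⟨z, ⟨-, hzm⟩, ⟨hzs, hzP⟩, ⟨-, hzP'⟩ | hz⟩ := hpre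
  · exact hzm (hm z hzs (le_antisymm hzP hzP'))
  · obtain ⟨s', hs', hz'⟩ := Set.mem_iUnion₂.1 hz
    obtain ⟨hs'S, hne⟩ := Set.mem_sdiff_singleton.1 hs'
    obtain ⟨r, rfl, hr', hr⟩ := Stitch.exists_incident_of_mem_seg hne hz' hzs
    refine hdead s' hs'S hne ?_
    rw [Metric.mem_closedBall, Prod.dist_eq, max_le_iff, Int.dist_cast_real, Int.dist_cast_real,
      Int.dist_eq, Int.dist_eq] at hzP
    have h1 : |r.1 - p.1| < 1 := by
      have : |(r.1 - p.1 : ℝ)| < 1 := by linarith [hzP.1]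
      exact_mod_cast this
    have h2 : |r.2 - p.2| < 1 := by
      have : |(r.2 - p.2 : ℝ)| < 1 := by linarith [hzP.2]
      exact_mod_cast this
    rw [Int.abs_lt_one_iff, sub_eq_zero] at h1 h2
    rwa [← Prod.ext h1 h2]

/-- If a union of stitches is connected, then it has no proper nonempty part closed under
adjacency of stitches. -/
lemma subset_of_isPreconnected_curveOf {S O : Set Stitch} (hS : S.Finite)
    (hC : IsPreconnected (curveOf S)) (hOS : O ⊆ S) (hO : O.Nonempty)
    (hadj : ∀ o ∈ O, ∀ s ∈ S, ∀ p, o.Incident p → s.Incident p → s ∈ O) : S ⊆ O := by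
  intro s hs
  by_contra hsO
  obtain ⟨o, ho⟩ := hO
  obtain ⟨p, hp, -⟩ := s.exists_incident_even
  obtain ⟨q, hq, -⟩ := o.exists_incident_even
  obtain ⟨z, -, hz, hz'⟩ := isPreconnected_closed_iff.1 hC (curveOf O) (curveOf (S \ O))
    (isClosed_curveOf (hS.subset hOS)) (isClosed_curveOf (hS.subset Set.sdiff_subset))
    (by
      rintro z hz
      obtain ⟨s', hs', hz'⟩ := Set.mem_iUnion₂.1 hz
      by_cases h : s' ∈ O
      · exact .inl (Stitch.seg_subset_curveOf h hz')
      · exact .inr (Stitch.seg_subset_curveOf (S := S \ O) ⟨hs', h⟩ hz'))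
    ⟨_, Stitch.seg_subset_curveOf (hOS ho) hq.mem_seg, Stitch.seg_subset_curveOf ho hq.mem_seg⟩
    ⟨_, Stitch.seg_subset_curveOf hs hp.mem_seg,
      Stitch.seg_subset_curveOf (S := S \ O) ⟨hs, hsO⟩ hp.mem_seg⟩
  obtain ⟨s₁, h₁, hz₁⟩ := Set.mem_iUnion₂.1 hz
  obtain ⟨s₂, h₂, hz₂⟩ := Set.mem_iUnion₂.1 hz'
  have hne : s₁ ≠ s₂ := by rintro rfl; exact h₂.2 h₁
  obtain ⟨r, -, hr₁, hr₂⟩ := Stitch.exists_incident_of_mem_seg hne hz₁ hz₂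
  exact h₂.2 (hadj s₁ h₁ s₂ h₂.1 r hr₁ hr₂)

/-- If a hitomezashi loop contains a stitch, then it contains the neighbouring ones. -/
lemma HLoop.mem_of_incident {ε η : ℤ → ZMod 2} (L : HLoop ε η) {s s' : Stitch}
    (hs : s ∈ L.stitches) (hs' : s'.InPattern ε η) {p : ℤ × ℤ} (hp : s.Incident p)
    (hp' : s'.Incident p) : s' ∈ L.stitches := by
  obtain ⟨t, ht, hts, htp⟩ := L.isCircle.exists_ne_incident L.stitches.finite_toSet hs hp
  rcases (L.inPattern s hs).eq_or_eq (L.inPattern t ht) hs' hp htp hp' hts.symm with rfl | rfl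
  · exact hs
  · exact ht

section Walk

variable (ε η : ℤ → ZMod 2)

/-- Equal to `1` if horizontal stitches on the line `y` are traversed eastwards by a walk that
enters them at points with even coordinate sum, and to `0` otherwise. -/
def eastward (y : ℤ) : ℤ := if (y : ZMod 2) = η y then 1 else 0

/-- Equal to `1` if vertical stitches on the line `x` are traversed northwards by a walk that
enters them at points with odd coordinate sum, and to `0` otherwise. -/
def northward (x : ℤ) : ℤ := if ((x + 1 : ℤ) : ZMod 2) = ε x then 1 else 0

/-- Two consecutive steps along a hitomezashi pattern, starting horizontally from a point with even
coordinate sum. -/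
def doubleStep (p : ℤ × ℤ) : ℤ × ℤ :=
  (p.1 + (2 * eastward η p.2 - 1),
    p.2 + (2 * northward ε (p.1 + (2 * eastward η p.2 - 1)) - 1))

/-- The first stitch traversed by `doubleStep`. -/
def firstStitch (p : ℤ × ℤ) : Stitch := .horiz (p.1 + eastward η p.2 - 1) p.2

/-- The second stitch traversed by `doubleStep`. -/
def secondStitch (p : ℤ × ℤ) : Stitch :=
  .vert (p.1 + (2 * eastward η p.2 - 1))
    (p.2 + northward ε (p.1 + (2 * eastward η p.2 - 1)) - 1)

lemma eastward_eq (y : ℤ) : eastward η y = 0 ∨ eastward η y = 1 := by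
  unfold eastward; split_ifs <;> simp

lemma northward_eq (x : ℤ) : northward ε x = 0 ∨ northward ε x = 1 := by
  unfold northward; split_ifs <;> simp

lemma doubleStep_injective : Function.Injective (doubleStep ε η) := by
  rintro ⟨x, y⟩ ⟨x', y'⟩ h
  simp only [doubleStep, Prod.mk.injEq] at h
  obtain ⟨h1, h2⟩ := h
  rw [h1] at h2
  obtain rfl : y = y' := by omega
  rw [show x = x' by omega]

lemma firstStitch_injective : Function.Injective (firstStitch η) := by
  rintro ⟨x, y⟩ ⟨x', y'⟩ h
  simp only [firstStitch, Stitch.horiz.injEq] at h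
  obtain ⟨h1, rfl⟩ := h
  rw [show x = x' by omega]

lemma secondStitch_injective : Function.Injective (secondStitch ε η) := by
  rintro ⟨x, y⟩ ⟨x', y'⟩ h
  simp only [secondStitch, Stitch.vert.injEq] at h
  obtain ⟨h1, h2⟩ := h
  rw [h1] at h2
  obtain rfl : y = y' := by omega
  rw [show x = x' by omega]

lemma even_doubleStep {p : ℤ × ℤ} (hp : Even (p.1 + p.2)) :
    Even ((doubleStep ε η p).1 + (doubleStep ε η p).2) := by
  rw [Int.even_iff] at *
  simp only [doubleStep]
  omega

lemma firstStitch_incident (p : ℤ × ℤ) : (firstStitch η p).Incident p := by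
  rcases eastward_eq η p.2 with h | h <;> simp [firstStitch, Stitch.Incident, h]

lemma firstStitch_incident_middle (p : ℤ × ℤ) :
    (firstStitch η p).Incident (p.1 + (2 * eastward η p.2 - 1), p.2) := by
  rcases eastward_eq η p.2 with h | h <;> simp [firstStitch, Stitch.Incident, h, sub_eq_add_neg]

lemma secondStitch_incident_middle (p : ℤ × ℤ) :
    (secondStitch ε η p).Incident (p.1 + (2 * eastward η p.2 - 1), p.2) := by
  rcases northward_eq ε (p.1 + (2 * eastward η p.2 - 1)) with h | h <;>
    simp [secondStitch, Stitch.Incident, h]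

lemma secondStitch_incident (p : ℤ × ℤ) : (secondStitch ε η p).Incident (doubleStep ε η p) := by
  refine ⟨rfl, ?_⟩
  have h := northward_eq ε (p.1 + (2 * eastward η p.2 - 1))
  dsimp only [doubleStep]
  omega

lemma ZMod.eq_add_one_of_ne {a b : ZMod 2} (h : a ≠ b) : b = a + 1 := by
  revert a b; decide

lemma firstStitch_inPattern {p : ℤ × ℤ} (hp : Even (p.1 + p.2)) :
    (firstStitch η p).InPattern ε η := by
  have hpar : (p.1 : ZMod 2) = p.2 := by
    rw [ZMod.intCast_eq_intCast_iff_dvd_sub]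
    rw [Int.even_iff] at hp
    omega
  simp only [firstStitch, Stitch.InPattern, eastward]
  split_ifs with h
  · rw [← h, ← hpar]; simp
  · rw [ZMod.eq_add_one_of_ne h, ← hpar]; push_cast
    rw [add_zero, CharTwo.sub_eq_add]

lemma secondStitch_inPattern {p : ℤ × ℤ} (hp : Even (p.1 + p.2)) :
    (secondStitch ε η p).InPattern ε η := by
  simp only [secondStitch, Stitch.InPattern]
  generalize hx : p.1 + (2 * eastward η p.2 - 1) = x
  have hpar : (p.2 : ZMod 2) = (x + 1 : ℤ) := by
    rw [ZMod.intCast_eq_intCast_iff_dvd_sub]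
    rw [Int.even_iff] at hp
    omega
  rw [northward]
  split_ifs with h
  · rw [← h, ← hpar]; simp
  · rw [ZMod.eq_add_one_of_ne h, ← hpar]; push_cast
    rw [add_zero, CharTwo.sub_eq_add]

end Walk

/-- Every hitomezashi loop has length (number of stitches)
congruent to `4` modulo `8`. -/
theorem hitomezashi_loop_length_mod_eight (ε η : ℤ → ZMod 2) (L : HLoop ε η) :
    L.stitches.card % 8 = 4 := by
  classical
  obtain ⟨_, hz⟩ := L.isCircle.nonempty
  obtain ⟨s₀, hs₀, -⟩ := Set.mem_iUnion₂.1 hz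
  obtain ⟨p, hp, heven⟩ := s₀.exists_incident_even
  set F := doubleStep ε η with hF
  set h : ℕ → Stitch := fun t ↦ firstStitch η (F^[t] p) with hh
  set w : ℕ → Stitch := fun t ↦ secondStitch ε η (F^[t] p) with hw
  have hevens (t : ℕ) : Even ((F^[t] p).1 + (F^[t] p).2) := by
    induction t with
    | zero => exact heven
    | succ t ih => rw [Function.iterate_succ_apply']; exact even_doubleStep ε η ih
  have hhP (t : ℕ) : (h t).InPattern ε η := firstStitch_inPattern ε η (hevens t)
  have hwP (t : ℕ) : (w t).InPattern ε η := secondStitch_inPattern ε η (hevens t)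
  have hwinc (t : ℕ) : (w t).Incident (F^[t + 1] p) := by
    rw [Function.iterate_succ_apply']; exact secondStitch_incident ε η _
  have hwL (t : ℕ) (ht : h t ∈ L.stitches) : w t ∈ L.stitches :=
    L.mem_of_incident ht (hwP t) (firstStitch_incident_middle η _)
      (secondStitch_incident_middle ε η _)
  have hhL (t : ℕ) : h t ∈ L.stitches := by
    induction t with
    | zero => exact L.mem_of_incident hs₀ (hhP 0) hp (firstStitch_incident η _)
    | succ t ih =>
      exact L.mem_of_incident (hwL t ih) (hhP (t + 1)) (hwinc t) (firstStitch_incident η _)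
  obtain ⟨a, b, hab, heq⟩ := L.stitches.finite_toSet.exists_lt_map_eq_of_forall_mem hhL
  have hperiodic : Function.IsPeriodicPt F (b - a) p := by
    refine (doubleStep_injective ε η).iterate a ?_
    rw [← Function.iterate_add_apply, Nat.add_sub_cancel' hab.le]
    exact (firstStitch_injective η heq).symm
  set n := Function.minimalPeriod F p with hn
  have hnpos : 0 < n := hperiodic.minimalPeriod_pos (by omega)
  have hadd (t : ℕ) : F^[t + n] p = F^[t] p := by
    rw [Function.iterate_add_apply, Function.iterate_minimalPeriod]
  have hmod (t : ℕ) : F^[t % n] p = F^[t] p := Function.iterate_mod_minimalPeriod_eq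
  have hmod4 : n % 4 = 2 := by
    refine period_mod_four (eastward_eq η) (northward_eq ε) (x := fun t ↦ (F^[t] p).1)
      (y := fun t ↦ (F^[t] p).2) ?_ ?_ hnpos ?_ ?_ ?_ heven
    · intro t; simp only [Function.iterate_succ_apply', hF, doubleStep]
    · intro t; simp only [Function.iterate_succ_apply', hF, doubleStep]
    · intro t; simp only [hadd]
    · intro t; simp only [hadd]
    · intro s t hst hts hx hy
      have hret : Function.IsPeriodicPt F (t - s) p := by
        refine (doubleStep_injective ε η).iterate s ?_
        rw [← Function.iterate_add_apply, Nat.add_sub_cancel' hst.le]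
        exact Prod.ext hx hy
      have := hret.minimalPeriod_le (by omega)
      omega
  have hinj : Set.InjOn (fun t ↦ F^[t] p) (Finset.range n) := by
    rw [Finset.coe_range]; exact Function.iterate_injOn_Iio_minimalPeriod
  set O : Finset Stitch := (Finset.range n).image h ∪ (Finset.range n).image w with hO
  have hhO (t : ℕ) : h t ∈ O := Finset.mem_union_left _
    (Finset.mem_image.2 ⟨t % n, Finset.mem_range.2 (Nat.mod_lt _ hnpos), by simp only [hh, hmod]⟩)
  have hwO (t : ℕ) : w t ∈ O := Finset.mem_union_right _
    (Finset.mem_image.2 ⟨t % n, Finset.mem_range.2 (Nat.mod_lt _ hnpos), by simp only [hw, hmod]⟩)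
  have hmemO {o : Stitch} (ho : o ∈ O) : ∃ t, o = h t ∨ o = w t := by
    rcases Finset.mem_union.1 ho with ho | ho <;> obtain ⟨t, -, rfl⟩ := Finset.mem_image.1 ho
    exacts [⟨t, .inl rfl⟩, ⟨t, .inr rfl⟩]
  have hne (s t : ℕ) : h s ≠ w t := by simp [hh, hw, firstStitch, secondStitch]
  have hOS : O ⊆ L.stitches := by
    intro o ho
    obtain ⟨t, rfl | rfl⟩ := hmemO ho
    exacts [hhL t, hwL t (hhL t)]
  have hvertex (t : ℕ) {s : Stitch} (hs : s ∈ L.stitches) (hsp : s.Incident (F^[t] p)) :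
      s ∈ O := by
    have hprev := hwinc (t + (n - 1))
    rw [add_assoc, Nat.sub_add_cancel hnpos, hadd] at hprev
    rcases (hhP t).eq_or_eq (hwP _) (L.inPattern s hs) (firstStitch_incident η _) hprev hsp
      (hne _ _) with rfl | rfl
    exacts [hhO _, hwO _]
  have hmiddle (t : ℕ) {s : Stitch} (hs : s ∈ L.stitches)
      (hsp : s.Incident ((F^[t] p).1 + (2 * eastward η (F^[t] p).2 - 1), (F^[t] p).2)) :
      s ∈ O := by
    rcases (hhP t).eq_or_eq (hwP t) (L.inPattern s hs) (firstStitch_incident_middle η _)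
      (secondStitch_incident_middle ε η _) hsp (hne _ _) with rfl | rfl
    exacts [hhO _, hwO _]
  have hLO : L.stitches ⊆ O := by
    refine Finset.coe_subset.1 <| subset_of_isPreconnected_curveOf L.stitches.finite_toSet
      L.isCircle.isPreconnected (Finset.coe_subset.2 hOS) ⟨h 0, hhO 0⟩ fun o ho s hs q hoq hsq ↦ ?_
    obtain ⟨t, rfl | rfl⟩ := hmemO ho
    · rcases (firstStitch_incident η (F^[t] p)).eq_or_eq (firstStitch_incident_middle η _) hoq
        (fun e ↦ by have := congrArg Prod.fst e; dsimp only at this; omega) with rfl | rfl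
      exacts [hvertex t hs hsq, hmiddle t hs hsq]
    · rcases (secondStitch_incident_middle ε η (F^[t] p)).eq_or_eq
        (secondStitch_incident ε η _) hoq
        (fun e ↦ by
          have := congrArg Prod.snd e
          simp only [doubleStep] at this
          omega) with rfl | rfl
      · exact hmiddle t hs hsq
      · rw [← hF, ← Function.iterate_succ_apply' F] at hsq
        exact hvertex (t + 1) hs hsq
  have hcard : O.card = 2 * n := by
    rw [hO, Finset.card_union_of_disjoint, Finset.card_image_of_injOn, Finset.card_image_of_injOn,
      Finset.card_range, two_mul]
    · exact (secondStitch_injective ε η).comp_injOn hinj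
    · exact (firstStitch_injective η).comp_injOn hinj
    · refine Finset.disjoint_left.2 fun s hs hs' ↦ ?_
      obtain ⟨a, -, rfl⟩ := Finset.mem_image.1 hs
      obtain ⟨b, -, hb⟩ := Finset.mem_image.1 hs'
      exact hne a b hb.symm
  rw [hLO.antisymm hOS, hcard]
  omega
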